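/- Let H be a complex Hilbert space and let T : H → H be a compact linear operator. Then there exist bounded operators N and Q on H such that N is normal (N N* = N* N), Q is quasinilpotent (its spectrum is contained in {0}), and T = N + Q. -/

import Mathlib

open ContinuousLinearMap

section aux
open Filter Topology InnerProductSpace
variable {H : Type*} [NormedAddCommGroup H] [InnerProductSpace ℂ H] [CompleteSpace H]

theorem schauder_aux (T : H →L[ℂ] H) (hT : IsCompactOperator T) :
    IsCompactOperator (adjoint T) := by
  have h1 : IsCompactOperator (T ∘L adjoint T) := hT.comp_clm (adjoint T)
  have h2 := (isCompactOperator_iff_isCompact_closure_image_closedBall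
    ((T ∘L adjoint T : H →L[ℂ] H) : H →ₗ[ℂ] H) zero_lt_one).1 h1
  have h3 := h2.totallyBounded.subset subset_closure
  refine (isCompactOperator_iff_isCompact_closure_image_closedBall
    ((adjoint T : H →L[ℂ] H) : H →ₗ[ℂ] H) zero_lt_one).2 ?_
  refine TotallyBounded.isCompact_of_isClosed (TotallyBounded.closure ?_) isClosed_closure
  refine Metric.totallyBounded_of_finite_discretization fun ε hε => ?_
  obtain ⟨t, htf, ht⟩ := Metric.totallyBounded_iff.1 h3 (ε ^ 2 / 4) (by positivity)
  have hx : ∀ x : ((adjoint T : H →L[ℂ] H) : H →ₗ[ℂ] H) '' Metric.closedBall 0 1,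
      ∃ u : H, ‖u‖ ≤ 1 ∧ adjoint T u = x ∧ ∃ c ∈ t, dist (T (adjoint T u)) c < ε ^ 2 / 4 := by
    rintro ⟨_, u, hu, rfl⟩
    refine ⟨u, by simpa using hu, rfl, ?_⟩
    simpa using ht ⟨u, hu, rfl⟩
  choose u hu1 hu2 c hct hc using hx
  refine ⟨t, htf.fintype, fun x => ⟨c x, hct x⟩, fun x y hxy => ?_⟩
  have hxy' : c x = c y := congrArg Subtype.val hxy
  have hd : dist (T (adjoint T (u x))) (T (adjoint T (u y))) < ε ^ 2 / 2 := by
    have := dist_triangle_right (T (adjoint T (u x))) (T (adjoint T (u y))) (c x)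
    have h1 := hc x
    have h2 := hc y
    rw [← hxy'] at h2
    linarith
  rw [dist_eq_norm, ← map_sub, ← map_sub] at hd
  rw [← hu2 x, ← hu2 y, dist_eq_norm, ← map_sub]
  set w := u x - u y
  have hw : ‖w‖ ≤ 2 := (norm_sub_le _ _).trans (by linarith [hu1 x, hu1 y])
  have : ‖adjoint T w‖ ^ 2 ≤ ‖T (adjoint T w)‖ * ‖w‖ := by
    have h := ContinuousLinearMap.apply_norm_sq_eq_inner_adjoint_left (adjoint T) w
    rw [adjoint_adjoint] at h
    rw [h]
    exact (Complex.re_le_norm _).trans (norm_inner_le_norm _ _)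
  refine lt_of_pow_lt_pow_left₀ 2 hε.le ?_
  nlinarith [norm_nonneg (T (adjoint T w)), norm_nonneg w]

theorem spec_adj_aux (Q : H →L[ℂ] H) (μ : ℂ) :
    star μ ∈ spectrum ℂ (adjoint Q) ↔ μ ∈ spectrum ℂ Q := by
  rw [← star_eq_adjoint, spectrum.map_star]
  simp

theorem eig_aux (Q : H →L[ℂ] H) (hQ : IsCompactOperator Q) (μ : ℂ) (hμ : μ ≠ 0)
    (h : μ ∈ spectrum ℂ Q) : ∃ v : H, ‖v‖ = 1 ∧ Q v = μ • v := by
  obtain ⟨v, hv⟩ := ((hQ.hasEigenvalue_iff_mem_spectrum hμ).2 h).exists_hasEigenvector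
  have hv1 : Q v = μ • v := hv.apply_eq_smul
  refine ⟨(‖v‖⁻¹ : ℂ) • v, ?_, ?_⟩
  · simp [norm_smul, hv.2]
  · rw [map_smul, hv1, smul_comm]

theorem mem_spec_aux (Q : H →L[ℂ] H) (μ : ℂ) (v : H) (hv : v ≠ 0) (h : Q v = μ • v) :
    μ ∈ spectrum ℂ Q := by
  rw [ContinuousLinearMap.spectrum_eq]
  exact (Module.End.hasEigenvalue_of_hasEigenvector
    (Module.End.hasEigenvector_iff.2 ⟨Module.End.mem_eigenspace_iff.2 h, hv⟩)).mem_spectrum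

theorem choice_aux (A : H →L[ℂ] H) (hA : IsCompactOperator A) :
    ∃ (e : H) (c : ℂ), A e = c • e ∧ ((e = 0 ∧ c = 0) ∨ (‖e‖ = 1 ∧ c ≠ 0)) ∧
      ∀ μ ∈ spectrum ℂ A, ‖μ‖ ≤ ‖c‖ := by
  by_cases h : ∃ μ ∈ spectrum ℂ A, μ ≠ 0
  · obtain ⟨μ, hμ, hμ0⟩ := h
    obtain ⟨c, hc, hmax⟩ := (spectrum.isCompact A).exists_isMaxOn ⟨μ, hμ⟩
      (continuous_norm.continuousOn)
    have hc0 : c ≠ 0 := by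
      have : ‖μ‖ ≤ ‖c‖ := hmax hμ
      exact norm_pos_iff.1 ((norm_pos_iff.2 hμ0).trans_le this)
    obtain ⟨e, he, hAe⟩ := eig_aux A hA c hc0 hc
    exact ⟨e, c, hAe, Or.inr ⟨he, hc0⟩, fun μ hμ => hmax hμ⟩
  · push Not at h
    exact ⟨0, 0, by simp, by simp, fun μ hμ => by simp [h μ hμ]⟩

/-- Bessel-type data for a sequence of pairwise orthogonal vectors of norm 0 or 1. -/
theorem norm_sum_aux (e : ℕ → H) (he : ∀ n, ‖e n‖ = 0 ∨ ‖e n‖ = 1)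
    (ho : ∀ i j, i ≠ j → inner ℂ (e i) (e j) = 0) (s : Finset ℕ) (a : ℕ → ℂ) (x : H) :
    ‖∑ i ∈ s, (a i * inner ℂ (e i) x) • e i‖ ^ 2 =
      ∑ i ∈ s, ‖a i‖ ^ 2 * ‖inner ℂ (e i) x‖ ^ 2 := by
  induction s using Finset.induction_on with
  | empty => simp
  | insert k s hk ih =>
    rw [Finset.sum_insert hk, Finset.sum_insert hk, ← ih, sq,
      norm_add_sq_eq_norm_sq_add_norm_sq_of_inner_eq_zero (𝕜 := ℂ), ← sq, ← sq]
    · congr 1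
      rcases he k with h | h
      · have : e k = 0 := norm_eq_zero.1 h
        simp [this]
      · rw [norm_smul, h, norm_mul]; ring
    · rw [inner_sum]
      refine Finset.sum_eq_zero fun i hi => ?_
      have : k ≠ i := fun h => hk (h ▸ hi)
      simp [inner_smul_left, inner_smul_right, ho k i this]

theorem bessel_aux (e : ℕ → H) (he : ∀ n, ‖e n‖ = 0 ∨ ‖e n‖ = 1)
    (ho : ∀ i j, i ≠ j → inner ℂ (e i) (e j) = 0) (s : Finset ℕ) (x : H) :
    ∑ i ∈ s, ‖inner ℂ (e i) x‖ ^ 2 ≤ ‖x‖ ^ 2 := by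
  have h := norm_sum_aux e he ho s (fun _ => 1) x
  simp only [one_mul, norm_one, one_pow] at h
  set y := ∑ i ∈ s, (inner ℂ (e i) x) • e i with hy
  have h2 : (inner ℂ y x) = ((∑ i ∈ s, ‖inner ℂ (e i) x‖ ^ 2 : ℝ) : ℂ) := by
    rw [hy, sum_inner]
    push_cast
    refine Finset.sum_congr rfl fun i _ => ?_
    rw [inner_smul_left, Complex.conj_mul']
  have h3 : ‖y‖ ^ 2 ≤ ‖y‖ * ‖x‖ := by
    have := norm_inner_le_norm (𝕜 := ℂ) y x
    rw [h2, ← h, Complex.norm_real, Real.norm_of_nonneg (by positivity)] at this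
    exact this
  rw [← h]
  have : ‖y‖ ≤ ‖x‖ := by
    by_contra! hlt
    nlinarith [norm_nonneg x]
  gcongr

theorem inner_tendsto_aux (e : ℕ → H) (he : ∀ n, ‖e n‖ = 0 ∨ ‖e n‖ = 1)
    (ho : ∀ i j, i ≠ j → inner ℂ (e i) (e j) = 0) (x : H) :
    Tendsto (fun n => inner ℂ (e n) x) atTop (𝓝 (0 : ℂ)) := by
  have hs : Summable (fun n => ‖inner ℂ (e n) x‖ ^ 2) :=
    summable_of_sum_le (fun _ => by positivity) (fun s => bessel_aux e he ho s x)
  have := hs.tendsto_atTop_zero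
  rw [tendsto_zero_iff_norm_tendsto_zero]
  have h2 := (Real.continuous_sqrt.tendsto 0).comp this
  simpa [Function.comp_def] using h2

theorem diag_tendsto_aux (T : H →L[ℂ] H) (hT : IsCompactOperator T)
    (e : ℕ → H) (he : ∀ n, ‖e n‖ = 0 ∨ ‖e n‖ = 1)
    (ho : ∀ i j, i ≠ j → inner ℂ (e i) (e j) = 0) :
    Tendsto (fun n => inner ℂ (e n) (T (e n))) atTop (𝓝 (0 : ℂ)) := by
  have he1 : ∀ n, ‖e n‖ ≤ 1 := fun n => by rcases he n with h | h <;> simp [h]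
  refine tendsto_of_subseq_tendsto fun ns hns => ?_
  obtain ⟨K, hK, hTK⟩ := hT.image_closedBall_subset_compact (f := (T : H →ₗ[ℂ] H)) 1
  obtain ⟨y, -, φ, hφ, hy⟩ := hK.tendsto_subseq (x := fun n => T (e (ns n)))
    (fun n => hTK ⟨e (ns n), by simpa using he1 _, rfl⟩)
  refine ⟨φ, ?_⟩
  have h1 := (inner_tendsto_aux e he ho y).comp (hns.comp hφ.tendsto_atTop)
  have h2 : Tendsto (fun n => inner ℂ (e (ns (φ n))) (T (e (ns (φ n))) - y)) atTop
      (𝓝 (0 : ℂ)) := by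
    refine squeeze_zero_norm (a := fun n => ‖T (e (ns (φ n))) - y‖) (fun n => ?_) ?_
    · refine (norm_inner_le_norm _ _).trans ?_
      exact mul_le_of_le_one_left (norm_nonneg _) (he1 _)
    · exact tendsto_iff_norm_sub_tendsto_zero.1 hy
  have h3 := h2.add h1
  simpa [inner_sub_right, Function.comp_def] using h3

theorem diag_exists_aux (e : ℕ → H) (he : ∀ n, ‖e n‖ = 0 ∨ ‖e n‖ = 1)
    (ho : ∀ i j, i ≠ j → inner ℂ (e i) (e j) = 0) (c : ℕ → ℂ)
    (hc : Tendsto c atTop (𝓝 0)) :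
    ∃ N : H →L[ℂ] H, IsCompactOperator N ∧ N * adjoint N = adjoint N * N ∧
      (∀ n, N (e n) = c n • e n) ∧ ∀ v, (∀ n, inner ℂ (e n) v = 0) → adjoint N v = 0 := by
  let F : ℕ → H →L[ℂ] H := fun k => ∑ i ∈ Finset.range k, c i • rankOne ℂ (e i) (e i)
  have hFx : ∀ k x, F k x = ∑ i ∈ Finset.range k, (c i * inner ℂ (e i) x) • e i := by
    intro k x
    simp [F, sum_apply, mul_smul]
  have hcau : CauchySeq F := by
    rw [Metric.cauchySeq_iff']
    intro ε hε
    obtain ⟨K, hK⟩ := Metric.tendsto_atTop.1 hc (ε / 2) (by positivity)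
    refine ⟨K, fun n hn => ?_⟩
    rw [dist_eq_norm]
    refine lt_of_le_of_lt (ContinuousLinearMap.opNorm_le_bound _ (M := ε / 2) (by positivity)
      fun x => ?_) (half_lt_self hε)
    rw [sub_apply, hFx, hFx, ← Finset.sum_Ico_eq_sub _ hn]
    refine (sq_le_sq₀ (norm_nonneg _) (by positivity)).1 ?_
    rw [norm_sum_aux e he ho]
    calc _ ≤ ∑ i ∈ Finset.Ico K n, (ε / 2) ^ 2 * ‖inner ℂ (e i) x‖ ^ 2 := by
          refine Finset.sum_le_sum fun i hi => ?_
          have := hK i (Finset.mem_Ico.1 hi).1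
          rw [dist_zero_right] at this
          gcongr
      _ ≤ _ := by
          rw [← Finset.mul_sum, mul_pow]
          gcongr
          exact bessel_aux e he ho _ x
  obtain ⟨N, hN⟩ := cauchySeq_tendsto_of_complete hcau
  have hNx : ∀ x, Tendsto (fun k => F k x) atTop (𝓝 (N x)) := fun x =>
    ((ContinuousLinearMap.apply ℂ H x).continuous.tendsto N).comp hN
  have hadj : Tendsto (fun k => adjoint (F k)) atTop (𝓝 (adjoint N)) :=
    ((adjoint (𝕜 := ℂ) (E := H) (F := H)).continuous.tendsto N).comp hN
  have hFadj : ∀ k, adjoint (F k) = ∑ i ∈ Finset.range k, star (c i) • rankOne ℂ (e i) (e i) := by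
    intro k
    simp only [F, map_sum]
    refine Finset.sum_congr rfl fun i _ => ?_
    rw [map_smulₛₗ, adjoint_rankOne]; rfl
  have hcomm : ∀ i j, Commute (rankOne ℂ (e i) (e i)) (rankOne ℂ (e j) (e j)) := by
    intro i j
    by_cases h : i = j
    · subst h; exact Commute.refl _
    · ext x
      simp [inner_smul_right, ho i j h, ho j i (Ne.symm h)]
  refine ⟨N, ?_, ?_, ?_, ?_⟩
  · refine isCompactOperator_of_tendsto hN (Eventually.of_forall fun k => ?_)
    change F k ∈ compactOperator (RingHom.id ℂ) H H
    refine Submodule.sum_mem _ fun i _ => Submodule.smul_mem _ _ ?_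
    change IsCompactOperator (rankOne ℂ (e i) (e i))
    rw [rankOne_def']
    exact (isCompactOperator_of_locallyCompactSpace_dom (innerSL ℂ (e i))).clm_comp
      (ContinuousLinearMap.toSpanSingleton ℂ (e i))
  · refine tendsto_nhds_unique (hN.mul hadj) ?_
    refine (hadj.mul hN).congr fun k => ?_
    rw [hFadj]
    refine (Commute.sum_left _ _ _ fun i _ => Commute.sum_right _ _ _ fun j _ => ?_).eq
    exact ((hcomm i j).smul_left _).smul_right _
  · intro n
    refine tendsto_nhds_unique (hNx (e n)) ?_
    refine tendsto_const_nhds.congr' ?_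
    filter_upwards [eventually_gt_atTop n] with k hk
    rw [hFx, Finset.sum_eq_single_of_mem n (Finset.mem_range.2 hk)]
    · rcases he n with h | h
      · simp [norm_eq_zero.1 h]
      · simp [inner_self_eq_norm_sq_to_K, h]
    · intro i _ hi
      simp [ho i n hi]
  · intro v hv
    refine tendsto_nhds_unique (((ContinuousLinearMap.apply ℂ H v).continuous.tendsto _).comp hadj) ?_
    refine tendsto_const_nhds.congr fun k => ?_
    simp [hFadj, sum_apply, hv]

theorem seq_exists_aux (T : H →L[ℂ] H) (hT : IsCompactOperator T) :
    ∃ (e : ℕ → H) (c : ℕ → ℂ) (P : ℕ → H →L[ℂ] H),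
      P 0 = 0 ∧ (∀ n, P (n + 1) = P n + rankOne ℂ (e n) (e n)) ∧
      ∀ n, ((1 - P n) * T * (1 - P n)) (e n) = c n • e n ∧
        ((e n = 0 ∧ c n = 0) ∨ (‖e n‖ = 1 ∧ c n ≠ 0)) ∧
        ∀ μ ∈ spectrum ℂ ((1 - P n) * T * (1 - P n)), ‖μ‖ ≤ ‖c n‖ := by
  have h : ∀ P : H →L[ℂ] H, IsCompactOperator ((1 - P) * T * (1 - P) : H →L[ℂ] H) := fun P => by
    have h2 : ((1 - P) * T * (1 - P) : H →L[ℂ] H) = ((1 - P) ∘L T) ∘L (1 - P) := rfl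
    rw [h2]
    exact (hT.clm_comp (1 - P)).comp_clm (1 - P)
  choose e c h1 h2 h3 using fun P : H →L[ℂ] H => choice_aux _ (h P)
  let P : ℕ → H →L[ℂ] H := fun n => Nat.rec 0 (fun _ P => P + rankOne ℂ (e P) (e P)) n
  exact ⟨fun n => e (P n), fun n => c (P n), P, rfl, fun n => rfl,
    fun n => ⟨h1 _, h2 _, h3 _⟩⟩

end aux

theorem compact_operator_normal_plus_quasinilpotent
    {H : Type*} [NormedAddCommGroup H] [InnerProductSpace ℂ H] [CompleteSpace H]
    (T : H →L[ℂ] H) (hT : IsCompactOperator T) :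
    ∃ N Q : H →L[ℂ] H,
      N * adjoint N = adjoint N * N ∧ spectrum ℂ Q ⊆ {0} ∧ T = N + Q := by
  obtain ⟨e, c, P, hP0, hPs, hall⟩ := seq_exists_aux T hT
  have he : ∀ n, ‖e n‖ = 0 ∨ ‖e n‖ = 1 := fun n => by
    rcases (hall n).2.1 with h | h
    · left; simp [h.1]
    · exact Or.inr h.1
  have hself : ∀ n, adjoint (P n) = P n := by
    intro n
    induction n with
    | zero => simp [hP0]
    | succ n ih => rw [hPs, map_add, ih, InnerProductSpace.adjoint_rankOne]
  have hinner : ∀ n x y, inner ℂ (P n x) y = inner ℂ x (P n y) := by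
    intro n x y
    rw [← adjoint_inner_right, hself]
  -- idempotent implies `P n` kills `e n`
  have hkill : ∀ n, (∀ x, P n (P n x) = P n x) → P n (e n) = 0 := by
    intro n hid
    rcases (hall n).2.1 with h | h
    · simp [h.1]
    · have h1 := congrArg (P n) (hall n).1
      simp only [mul_apply_eq_comp, sub_apply,
        one_apply_eq_self, map_sub, map_smul, hid, sub_self] at h1
      exact (smul_eq_zero.1 h1.symm).resolve_left h.2
  have hid : ∀ n x, P n (P n x) = P n x := by
    intro n
    induction n with
    | zero => simp [hP0]
    | succ n ih =>
      intro x
      have hk := hkill n ih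
      have h0 : inner ℂ (e n) (P n x) = 0 := by rw [← hinner, hk, inner_zero_left]
      rw [hPs]
      simp only [add_apply, InnerProductSpace.rankOne_apply, map_add, map_smul,
        ih, hk, h0, inner_smul_right, smul_zero, add_zero, zero_add, zero_smul]
      rcases he n with h | h
      · simp [norm_eq_zero.1 h]
      · simp [inner_self_eq_norm_sq_to_K, h]
  have hPe : ∀ n, P n (e n) = 0 := fun n => hkill n (hid n)
  have hfix : ∀ n i, i < n → P n (e i) = e i := by
    intro n
    induction n with
    | zero => intro i hi; omega
    | succ n ih =>
      intro i hi
      rw [hPs]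
      rcases Nat.lt_succ_iff_lt_or_eq.1 hi with h | h
      · have h0 : inner ℂ (e n) (e i) = 0 := by
          rw [← ih i h, ← hinner, hPe, inner_zero_left]
        simp [ih i h, h0]
      · subst h
        rcases he i with h | h
        · simp [norm_eq_zero.1 h]
        · simp [inner_self_eq_norm_sq_to_K, h, hPe]
  have holt : ∀ i n, i < n → inner ℂ (e n) (e i) = 0 := by
    intro i n h
    rw [← hfix n i h, ← hinner, hPe, inner_zero_left]
  have ho : ∀ i j, i ≠ j → inner ℂ (e i) (e j) = 0 := by
    intro i j hij
    rcases lt_or_gt_of_ne hij with h | h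
    · exact inner_eq_zero_symm.1 (holt i j h)
    · exact holt j i h
  have hTe : ∀ n, T (e n) - P n (T (e n)) = c n • e n := by
    intro n
    simpa [hPe n] using (hall n).1
  have hvanish : ∀ v n, (∀ i, i < n → inner ℂ (e i) v = 0) → P n v = 0 := by
    intro v n
    induction n with
    | zero => simp [hP0]
    | succ n ih =>
      intro h
      rw [hPs, add_apply, ih fun i hi => h i (by omega), InnerProductSpace.rankOne_apply,
        h n (by omega)]
      simp
  have hcd : ∀ n, c n = inner ℂ (e n) (T (e n)) := by
    intro n
    have h1 : T (e n) = c n • e n + P n (T (e n)) := by rw [← hTe n]; abel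
    rw [h1, inner_add_right, ← hinner, hPe, inner_zero_left, add_zero, inner_smul_right]
    rcases (hall n).2.1 with h | h
    · simp [h.2]
    · simp [inner_self_eq_norm_sq_to_K, h.1]
  have hc : Filter.Tendsto c Filter.atTop (nhds 0) :=
    (diag_tendsto_aux T hT e he ho).congr fun n => (hcd n).symm
  obtain ⟨N, hNc, hNn, hNe, hNv⟩ := diag_exists_aux e he ho c hc
  refine ⟨N, T - N, hNn, ?_, by abel⟩
  intro μ hμ
  by_contra hμ0
  rw [Set.mem_singleton_iff] at hμ0
  have hQc : IsCompactOperator (T - N) := hT.sub hNc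
  obtain ⟨v, hv1, hv⟩ := eig_aux _ (schauder_aux _ hQc) (star μ) (star_ne_zero.2 hμ0)
    ((spec_adj_aux _ _).2 hμ)
  have hv0 : v ≠ 0 := by
    rw [← norm_ne_zero_iff, hv1]; exact one_ne_zero
  have horth : ∀ n, inner ℂ (e n) v = 0 := by
    intro n
    induction n using Nat.strong_induction_on with
    | _ n ih =>
      have h1 : (T - N) (e n) = P n (T (e n)) := by
        rw [sub_apply, hNe, ← hTe]; abel
      have h2 : inner ℂ ((T - N) (e n)) v = 0 := by
        rw [h1, hinner, hvanish v n ih, inner_zero_right]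
      rw [← adjoint_inner_right, hv, inner_smul_right] at h2
      exact (mul_eq_zero.1 h2).resolve_left (star_ne_zero.2 hμ0)
  have hTv : adjoint T v = star μ • v := by
    rw [map_sub, sub_apply, hNv v horth, sub_zero] at hv
    exact hv
  have hle : ∀ n, ‖μ‖ ≤ ‖c n‖ := by
    intro n
    refine (hall n).2.2 μ ((spec_adj_aux _ _).1 (mem_spec_aux _ _ v hv0 ?_))
    have hPv : P n v = 0 := hvanish v n fun i _ => horth i
    have : adjoint ((1 - P n) * T * (1 - P n)) = (1 - P n) * (adjoint T * (1 - P n)) := by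
      rw [← star_eq_adjoint, star_mul, star_mul, star_sub, star_one, star_eq_adjoint,
        star_eq_adjoint, hself]
    rw [this]
    simp [hPv, hTv]
  have h0 : ‖μ‖ ≤ 0 := by
    have := hc.norm
    rw [norm_zero] at this
    exact ge_of_tendsto' this hle
  exact hμ0 (norm_le_zero_iff.1 h0)
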